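/- For α ≥ 0 let P^T_{Y^{(α)},T} denote the law on (C[0,T], ℬ(C[0,T])) of the almost surely continuous extension (Y^{(α)}_t)_{t∈[0,T]} of X^{(α)} (where Y^{(α)}_t := X^{(α)}_t for t ∈ [0,T), with Y^{(α)}_T := 0 if α > 0 and Y^{(0)}_T := B_T if α = 0). Then for all α, β ≥ 0 with α ≠ β, the measures P^T_{Y^{(α)},T} and P^T_{Y^{(β)},T} are mutually singular. In particular, for every α > 0 the measure P^T_{Y^{(α)},T} is singular with respect to the standard Wiener measure on (C[0,T], ℬ(C[0,T])). -/

import Mathlib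

open MeasureTheory ProbabilityTheory Filter Set Topology
open scoped ENNReal NNReal

noncomputable section

variable {Ω : Type*} [MeasurableSpace Ω]

/-- `B` is a standard 1-dimensional Wiener process on the probability space `(Ω, 𝒜, P)`:
it starts at `0`, has a.s. continuous paths, and its increments are independent of the past
and Gaussian with the correct variance. -/
structure IsStandardWiener (P : Measure Ω) (B : ℝ → Ω → ℝ) : Prop where
  meas : ∀ t : ℝ, Measurable (B t)
  init : ∀ᵐ ω ∂P, B 0 ω = 0
  cont : ∀ᵐ ω ∂P, Continuous fun t => B t ω
  incr_indep : ∀ s t : ℝ, 0 ≤ s → s ≤ t →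
    IndepFun (fun ω => B t ω - B s ω) (fun ω (u : Set.Icc (0:ℝ) s) => B u.1 ω) P
  incr_law : ∀ s t : ℝ, 0 ≤ s → s ≤ t →
    Measure.map (fun ω => B t ω - B s ω) P = gaussianReal 0 (Real.toNNReal (t - s))

/-- The `α`-Wiener bridge `X^{(α)}_t = ∫₀ᵗ ((T−t)/(T−s))^α dB_s`, `t ∈ [0,T)`, realized
pathwise through the integration-by-parts representation of the Wiener integral:
`X^{(α)}_t = B_t − α (T−t)^α ∫₀ᵗ (T−s)^{−α−1} B_s ds`. -/
def alphaWienerBridge (T α : ℝ) (B : ℝ → Ω → ℝ) (t : ℝ) (ω : Ω) : ℝ :=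
  B t ω - α * (T - t) ^ α * ∫ s in Set.Ioc (0:ℝ) t, (T - s) ^ (-α - 1) * B s ω

open scoped Classical

/-- The almost surely continuous extension `Y^{(α)}` of `X^{(α)}` to `[0,T]`:
`Y^{(α)}_t = X^{(α)}_t` for `t < T`, `Y^{(α)}_T = 0` for `α > 0`, and `Y^{(0)}_T = B_T`
(for `α = 0` one has `X^{(0)} = B`). -/
def bridgeExtensionFull (T α : ℝ) (B : ℝ → Ω → ℝ) (t : ℝ) (ω : Ω) : ℝ :=
  if t < T then alphaWienerBridge T α B t ω else if α = 0 then B T ω else 0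

/-- The supremum distance `sup_{s∈[0,T]} |x(s) − y(s)|` on `C[0,T]`. -/
def supDist (T : ℝ) (x y : ℝ → ℝ) : ℝ := sSup ((fun s => |x s - y s|) '' Set.Icc (0:ℝ) T)

/-- The space `C[0,T]` of continuous real-valued functions on `[0,T]`. -/
def ContPathIcc (T : ℝ) : Type := {x : ℝ → ℝ // ContinuousOn x (Set.Icc 0 T)}

/-- The Borel σ-algebra of the separable metric space `C[0,T]`, generated by the open balls of
the supremum metric. -/
def borelSup (T : ℝ) : MeasurableSpace (ContPathIcc T) :=
  MeasurableSpace.generateFrom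
    {S : Set (ContPathIcc T) | ∃ (x : ContPathIcc T) (r : ℝ),
      S = {y : ContPathIcc T | supDist T x.1 y.1 < r}}

/-- The path map `ω ↦ (Y^{(α)}_t(ω))_{t∈[0,T]} ∈ C[0,T]` (with an irrelevant default on the
null set where the path fails to be continuous). -/
def extBridgePath (T α : ℝ) (B : ℝ → Ω → ℝ) (ω : Ω) : ContPathIcc T :=
  if h : ContinuousOn (fun t => bridgeExtensionFull T α B t ω) (Set.Icc 0 T)
  then ⟨fun t => bridgeExtensionFull T α B t ω, h⟩
  else ⟨fun _ => 0, continuousOn_const⟩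

/-- The Wiener integral `∫ₐᵇ f dB` of a `C¹` function `f` with derivative `f'`, realized pathwise by
integration by parts. -/
def parts (f f' x : ℝ → ℝ) (a b : ℝ) : ℝ :=
  f b * x b - f a * x a - ∫ s in a..b, f' s * x s

/-- The `i`-th point of the uniform partition of `[a,b]` into `n` pieces. -/
def gridPoint (a b : ℝ) (n i : ℕ) : ℝ := a + i * ((b - a) / n)

/-- The left Riemann–Stieltjes sum of `f dx` along the uniform partition of `[a,b]`. -/
def stieltjesSum (f x : ℝ → ℝ) (a b : ℝ) (n : ℕ) : ℝ :=
  ∑ i ∈ Finset.range n,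
    f (gridPoint a b n i) * (x (gridPoint a b n (i + 1)) - x (gridPoint a b n i))

lemma gridPoint_mono {a b : ℝ} (hab : a ≤ b) (n : ℕ) : Monotone (gridPoint a b n) := by
  intro i j hij
  have : 0 ≤ (b - a) / n := div_nonneg (by linarith) (by positivity)
  have h2 : (i : ℝ) ≤ j := by exact_mod_cast hij
  unfold gridPoint
  nlinarith

lemma gridPoint_zero (a b : ℝ) (n : ℕ) : gridPoint a b n 0 = a := by simp [gridPoint]

lemma gridPoint_self (a b : ℝ) {n : ℕ} (hn : n ≠ 0) : gridPoint a b n n = b := by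
  have : (n : ℝ) ≠ 0 := by exact_mod_cast hn
  unfold gridPoint
  field_simp
  ring

lemma gridPoint_mem {a b : ℝ} (hab : a ≤ b) {n i : ℕ} (hi : i ≤ n) :
    gridPoint a b n i ∈ Icc a b := by
  rcases Nat.eq_zero_or_pos n with h0 | h0
  · have : i = 0 := by omega
    subst this
    simp [gridPoint_zero, hab]
  refine ⟨?_, ?_⟩
  · have := gridPoint_mono hab n (Nat.zero_le i)
    rwa [gridPoint_zero] at this
  · have := gridPoint_mono hab n hi
    rwa [gridPoint_self a b h0.ne'] at this

lemma tendsto_stieltjesSum {f f' x : ℝ → ℝ} {a b : ℝ} (hab : a ≤ b)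
    (hf : ∀ s ∈ Icc a b, HasDerivAt f (f' s) s) (hf' : ContinuousOn f' (Icc a b))
    (hx : ContinuousOn x (Icc a b)) :
    Tendsto (stieltjesSum f x a b) atTop (𝓝 (parts f f' x a b)) := by
  obtain ⟨C, hC⟩ := isCompact_Icc.exists_bound_of_continuousOn hf'
  have hC0 : 0 ≤ C := (norm_nonneg _).trans (hC a ⟨le_rfl, hab⟩)
  have hux := isCompact_Icc.uniformContinuousOn_of_continuous hx
  rw [Metric.uniformContinuousOn_iff] at hux
  rw [Metric.tendsto_atTop]
  intro ε hε
  obtain ⟨δ, hδ, hδx⟩ := hux (ε / (2 * (C * (b - a) + 1))) (by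
    have : 0 ≤ C * (b - a) := mul_nonneg hC0 (by linarith)
    positivity)
  obtain ⟨N, hN⟩ := exists_nat_gt ((b - a) / δ)
  refine ⟨N + 1, fun n hn => ?_⟩
  have hn0 : 0 < n := by omega
  have hnr : (0 : ℝ) < n := by exact_mod_cast hn0
  have hmesh : (b - a) / n < δ := by
    have : (N : ℝ) < n := by exact_mod_cast hn
    rw [div_lt_iff₀ hδ] at hN
    rw [div_lt_iff₀ hnr]
    nlinarith
  have hstep : ∀ i, gridPoint a b n (i + 1) - gridPoint a b n i = (b - a) / n := by
    intro i
    unfold gridPoint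
    push_cast
    ring
  have hsub : ∀ i < n, uIcc (gridPoint a b n i) (gridPoint a b n (i + 1)) ⊆ Icc a b := by
    intro i hi
    rw [uIcc_of_le (gridPoint_mono hab n (Nat.le_succ i))]
    exact Icc_subset_Icc (gridPoint_mem hab hi.le).1 (gridPoint_mem hab hi).2
  have hint : ∀ i < n, IntervalIntegrable (fun s => f' s * x s) volume
      (gridPoint a b n i) (gridPoint a b n (i + 1)) := fun i hi =>
    ((hf'.mul hx).mono (hsub i hi)).intervalIntegrable
  have hint' : ∀ i < n, IntervalIntegrable f' volume
      (gridPoint a b n i) (gridPoint a b n (i + 1)) := fun i hi =>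
    (hf'.mono (hsub i hi)).intervalIntegrable
  have hsum : ∫ s in a..b, f' s * x s = ∑ i ∈ Finset.range n,
      ∫ s in gridPoint a b n i..gridPoint a b n (i + 1), f' s * x s := by
    rw [intervalIntegral.sum_integral_adjacent_intervals hint, gridPoint_zero,
      gridPoint_self a b hn0.ne']
  have htel : f b * x b - f a * x a = ∑ i ∈ Finset.range n,
      (f (gridPoint a b n (i + 1)) * x (gridPoint a b n (i + 1))
        - f (gridPoint a b n i) * x (gridPoint a b n i)) := by
    rw [Finset.sum_range_sub (fun i => f (gridPoint a b n i) * x (gridPoint a b n i)),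
      gridPoint_zero, gridPoint_self a b hn0.ne']
  have hdiff : stieltjesSum f x a b n - parts f f' x a b = ∑ i ∈ Finset.range n,
      ∫ s in gridPoint a b n i..gridPoint a b n (i + 1),
        f' s * (x s - x (gridPoint a b n (i + 1))) := by
    unfold stieltjesSum parts
    rw [htel, hsum, ← Finset.sum_sub_distrib, ← Finset.sum_sub_distrib]
    refine Finset.sum_congr rfl fun i hi => ?_
    have hi' := Finset.mem_range.1 hi
    have h1 : ∫ s in gridPoint a b n i..gridPoint a b n (i + 1), f' s
        = f (gridPoint a b n (i + 1)) - f (gridPoint a b n i) :=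
      intervalIntegral.integral_eq_sub_of_hasDerivAt
        (fun s hs => hf s (hsub i hi' hs)) (hint' i hi')
    simp_rw [mul_sub]
    rw [intervalIntegral.integral_sub (hint i hi') ((hint' i hi').mul_const _),
      intervalIntegral.integral_mul_const, h1]
    ring
  have hbound : ∀ i ∈ Finset.range n,
      ‖∫ s in gridPoint a b n i..gridPoint a b n (i + 1),
        f' s * (x s - x (gridPoint a b n (i + 1)))‖
        ≤ C * (ε / (2 * (C * (b - a) + 1))) * ((b - a) / n) := by
    intro i hi
    have hi' := Finset.mem_range.1 hi
    have h0 := gridPoint_mono hab n (Nat.le_succ i)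
    have := intervalIntegral.norm_integral_le_of_norm_le_const
      (a := gridPoint a b n i) (b := gridPoint a b n (i + 1))
      (f := fun s => f' s * (x s - x (gridPoint a b n (i + 1))))
      (C := C * (ε / (2 * (C * (b - a) + 1)))) (by
        intro s hs
        have hs' := hsub i hi' (uIoc_subset_uIcc hs)
        rw [uIoc_of_le h0] at hs
        rw [norm_mul]
        refine mul_le_mul (hC s hs') ?_ (norm_nonneg _) hC0
        refine (hδx s hs' _ (gridPoint_mem hab hi') ?_).le
        rw [Real.dist_eq, abs_lt]
        have := hstep i
        constructor <;> linarith [hs.1, hs.2])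
    rwa [hstep i, abs_of_nonneg (div_nonneg (by linarith) hnr.le)] at this
  rw [dist_eq_norm, hdiff]
  refine (norm_sum_le_of_le _ hbound).trans_lt ?_
  rw [Finset.sum_const, Finset.card_range, nsmul_eq_mul]
  have h1 : (n : ℝ) * (C * (ε / (2 * (C * (b - a) + 1))) * ((b - a) / n))
      = (C * (b - a)) * ε / (2 * (C * (b - a) + 1)) := by field_simp
  rw [h1]
  have : 0 ≤ C * (b - a) := mul_nonneg hC0 (by linarith)
  rw [div_lt_iff₀ (by positivity)]
  nlinarith

/-- Variances of the Riemann–Stieltjes sums converge to `∫ f²`. -/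
lemma tendsto_sum_sq {f f' : ℝ → ℝ} {a b : ℝ} (hab : a ≤ b)
    (hf : ∀ s ∈ Icc a b, HasDerivAt f (f' s) s) (hf' : ContinuousOn f' (Icc a b)) :
    Tendsto (fun n => ∑ i ∈ Finset.range n, f (gridPoint a b n i) ^ 2 *
      (gridPoint a b n (i + 1) - gridPoint a b n i)) atTop (𝓝 (∫ s in a..b, f s ^ 2)) := by
  have hfc : ContinuousOn f (Icc a b) := fun s hs => (hf s hs).continuousAt.continuousWithinAt
  have hf2 : ∀ s ∈ Icc a b, HasDerivAt (fun s => f s ^ 2) (2 * f s * f' s) s := by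
    intro s hs
    have := (hf s hs).pow 2
    simp only [Nat.cast_ofNat, Nat.add_one_sub_one, pow_one] at this
    exact this
  have hf2' : ContinuousOn (fun s => 2 * f s * f' s) (Icc a b) := by fun_prop
  have h := tendsto_stieltjesSum hab hf2 hf2' (x := fun s => s) continuousOn_id
  have hparts : parts (fun s => f s ^ 2) (fun s => 2 * f s * f' s) (fun s => s) a b
      = ∫ s in a..b, f s ^ 2 := by
    have hd : ∀ s ∈ uIcc a b,
        HasDerivAt (fun s => f s ^ 2 * s) (2 * f s * f' s * s + f s ^ 2 * 1) s := fun s hs =>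
      (hf2 s (by rwa [uIcc_of_le hab] at hs)).mul (hasDerivAt_id s)
    have := intervalIntegral.integral_eq_sub_of_hasDerivAt hd (by
      apply ContinuousOn.intervalIntegrable
      rw [uIcc_of_le hab]
      fun_prop)
    unfold parts
    rw [← this, ← intervalIntegral.integral_sub]
    · simp
    · apply ContinuousOn.intervalIntegrable
      rw [uIcc_of_le hab]
      fun_prop
    · apply ContinuousOn.intervalIntegrable
      rw [uIcc_of_le hab]
      fun_prop
  rw [hparts] at h
  exact h

/-- The σ-algebra generated by `(B_u)_{0 ≤ u ≤ s}`. -/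
abbrev past (B : ℝ → Ω → ℝ) (s : ℝ) : MeasurableSpace Ω :=
  MeasurableSpace.comap (fun ω (u : Set.Icc (0 : ℝ) s) => B u.1 ω) inferInstance

lemma measurable_past {Ω₀ : Type*} (B : ℝ → Ω₀ → ℝ) {s u : ℝ} (hu : 0 ≤ u) (hus : u ≤ s) :
    Measurable[past B s] (B u) :=
  (measurable_pi_apply (⟨u, hu, hus⟩ : Set.Icc (0 : ℝ) s)).comp
    (comap_measurable fun ω (u : Set.Icc (0 : ℝ) s) => B u.1 ω)

lemma past_le {B : ℝ → Ω → ℝ} (hB : ∀ t, Measurable (B t)) (s : ℝ) :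
    past B s ≤ (inferInstance : MeasurableSpace Ω) :=
  Measurable.comap_le (measurable_pi_lambda _ fun u => hB u.1)

lemma past_mono {Ω₀ : Type*} (B : ℝ → Ω₀ → ℝ) {s t : ℝ} (hst : s ≤ t) : past B s ≤ past B t := by
  rw [← measurable_iff_comap_le]
  refine @measurable_pi_lambda _ _ _ (past B t) _ _ fun u => ?_
  exact measurable_past B u.2.1 (u.2.2.trans hst)

section Wiener

variable {P : Measure Ω} {B : ℝ → Ω → ℝ}

lemma IsStandardWiener.charFun_increment (hB : IsStandardWiener P B) {s t : ℝ} (hs : 0 ≤ s)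
    (hst : s ≤ t) (c : ℝ) :
    ∫ ω, Complex.exp (Complex.I * ((c * (B t ω - B s ω) : ℝ) : ℂ)) ∂P
      = Complex.exp (-((c ^ 2 * (t - s) : ℝ) : ℂ) / 2) := by
  have h := charFun_gaussianReal (μ := 0) (v := Real.toNNReal (t - s)) c
  rw [← hB.incr_law s t hs hst, charFun_apply_real, integral_map] at h
  · rw [show (fun ω => Complex.exp (Complex.I * ((c * (B t ω - B s ω) : ℝ) : ℂ)))
      = fun ω => Complex.exp (c * ((B t ω - B s ω : ℝ) : ℂ) * Complex.I) by
        ext ω; push_cast; ring_nf, h]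
    have : ((Real.toNNReal (t - s) : ℝ) : ℂ) = ((t - s : ℝ) : ℂ) := by
      rw [Real.coe_toNNReal _ (by linarith)]
    rw [this]
    push_cast
    ring_nf
  · exact ((hB.meas t).sub (hB.meas s)).aemeasurable
  · fun_prop

lemma IsStandardWiener.integral_mul_increment (hB : IsStandardWiener P B) {s t : ℝ} (hs : 0 ≤ s)
    (hst : s ≤ t) (c : ℝ) {φ : Ω → ℂ} (hφ : Measurable[past B s] φ) :
    ∫ ω, φ ω * Complex.exp (Complex.I * ((c * (B t ω - B s ω) : ℝ) : ℂ)) ∂P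
      = (∫ ω, φ ω ∂P) * Complex.exp (-((c ^ 2 * (t - s) : ℝ) : ℂ) / 2) := by
  have hind : IndepFun φ (fun ω => B t ω - B s ω) P := by
    rw [IndepFun_iff_Indep]
    refine indep_of_indep_of_le_left ((IndepFun_iff_Indep _ _ _).1 (hB.incr_indep s t hs hst)).symm
      hφ.comap_le
  have h2 := hind.comp measurable_id
    (show Measurable fun y : ℝ => Complex.exp (Complex.I * ((c * y : ℝ) : ℂ)) by fun_prop)
  have := h2.integral_fun_mul_eq_mul_integral
    (hφ.mono (past_le hB.meas s) le_rfl).aestronglyMeasurable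
    (Measurable.aestronglyMeasurable (by
      have := hB.meas t
      have := hB.meas s
      fun_prop))
  rw [← hB.charFun_increment hs hst c]
  exact this

lemma IsStandardWiener.integral_mul_sum (hB : IsStandardWiener P B) (c τ : ℕ → ℝ)
    (hτ : Monotone τ) (hτ0 : 0 ≤ τ 0) {φ : Ω → ℂ} (hφ : Measurable[past B (τ 0)] φ) (n : ℕ) :
    ∫ ω, φ ω * Complex.exp (Complex.I *
        ((∑ i ∈ Finset.range n, c i * (B (τ (i + 1)) ω - B (τ i) ω) : ℝ) : ℂ)) ∂P
      = (∫ ω, φ ω ∂P) * Complex.exp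
        (-((∑ i ∈ Finset.range n, c i ^ 2 * (τ (i + 1) - τ i) : ℝ) : ℂ) / 2) := by
  induction n with
  | zero => simp
  | succ n ih =>
    have hpos : ∀ i, 0 ≤ τ i := fun i => hτ0.trans (hτ (Nat.zero_le i))
    have hm : Measurable[past B (τ n)] fun ω => φ ω * Complex.exp (Complex.I *
        ((∑ i ∈ Finset.range n, c i * (B (τ (i + 1)) ω - B (τ i) ω) : ℝ) : ℂ)) := by
      refine Measurable.mul (hφ.mono (past_mono B (hτ (Nat.zero_le n))) le_rfl) ?_
      refine Complex.measurable_exp.comp (Measurable.const_mul (Complex.measurable_ofReal.comp ?_) _)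
      refine Finset.measurable_fun_sum _ fun i hi => ?_
      have hi := Finset.mem_range.1 hi
      exact ((measurable_past B (hpos _) (hτ hi)).sub
        (measurable_past B (hpos _) (hτ hi.le))).const_mul _
    have := hB.integral_mul_increment (hpos n) (hτ (Nat.le_succ n)) (c n) hm
    rw [ih, Nat.succ_eq_add_one] at this
    simp only [Finset.sum_range_succ]
    rw [show ∀ x y : ℝ, Complex.exp (-((x + y : ℝ) : ℂ) / 2)
        = Complex.exp (-(x : ℂ) / 2) * Complex.exp (-(y : ℂ) / 2) by
          intro x y; rw [← Complex.exp_add]; push_cast; ring_nf, ← mul_assoc, ← this]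
    refine integral_congr_ae (ae_of_all _ fun ω => ?_)
    simp only
    rw [mul_assoc, ← Complex.exp_add]
    push_cast
    ring_nf

/-- A multiplicative characteristic-function identity passes to almost sure limits. -/
lemma tendsto_integral_mul_exp [IsProbabilityMeasure P] {φ : ℕ → Ω → ℂ} {ψ : Ω → ℂ} {S : ℕ → Ω → ℝ}
    {W : Ω → ℝ}
    (hφ : ∀ n, Measurable (φ n)) (hφ1 : ∀ n ω, ‖φ n ω‖ ≤ 1)
    (hφψ : ∀ᵐ ω ∂P, Tendsto (fun n => φ n ω) atTop (𝓝 (ψ ω)))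
    (hS : ∀ n, Measurable (S n)) (hSW : ∀ᵐ ω ∂P, Tendsto (fun n => S n ω) atTop (𝓝 (W ω))) :
    Tendsto (fun n => ∫ ω, φ n ω * Complex.exp (Complex.I * (S n ω : ℂ)) ∂P) atTop
      (𝓝 (∫ ω, ψ ω * Complex.exp (Complex.I * (W ω : ℂ)) ∂P)) := by
  refine tendsto_integral_of_dominated_convergence (fun _ => 1)
    (fun n => ?_) (integrable_const _) (fun n => ae_of_all _ fun ω => ?_) ?_
  · have := hφ n
    have := hS n
    exact Measurable.aestronglyMeasurable (by fun_prop)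
  · rw [norm_mul, mul_comm Complex.I, Complex.norm_exp_ofReal_mul_I, mul_one]
    exact hφ1 n ω
  · filter_upwards [hφψ, hSW] with ω h1 h2
    refine h1.mul ?_
    exact ((Complex.continuous_exp.comp (continuous_const.mul Complex.continuous_ofReal)).tendsto
      (W ω)).comp h2

lemma measurable_stieltjesSum (hB : IsStandardWiener P B) (f : ℝ → ℝ) (a b : ℝ) (n : ℕ) :
    Measurable fun ω => stieltjesSum f (fun t => B t ω) a b n :=
  Finset.measurable_fun_sum _ fun _ _ => ((hB.meas _).sub (hB.meas _)).const_mul _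

lemma measurable_past_stieltjesSum {Ω₀ : Type*} (B : ℝ → Ω₀ → ℝ) (f : ℝ → ℝ) {a b : ℝ} (ha : 0 ≤ a)
    (hab : a ≤ b) (n : ℕ) :
    Measurable[past B b] fun ω => stieltjesSum f (fun t => B t ω) a b n := by
  refine Finset.measurable_fun_sum _ fun i hi => ?_
  have hi := Finset.mem_range.1 hi
  have h1 := gridPoint_mem hab (i := i + 1) (n := n) hi
  have h2 := gridPoint_mem hab (i := i) (n := n) hi.le
  exact ((measurable_past B (ha.trans h1.1) h1.2).sub
    (measurable_past B (ha.trans h2.1) h2.2)).const_mul _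

lemma ae_tendsto_stieltjesSum (hB : IsStandardWiener P B) {f f' : ℝ → ℝ} {a b : ℝ} (hab : a ≤ b)
    (hf : ∀ s ∈ Icc a b, HasDerivAt f (f' s) s) (hf' : ContinuousOn f' (Icc a b)) :
    ∀ᵐ ω ∂P, Tendsto (fun n => stieltjesSum f (fun t => B t ω) a b n) atTop
      (𝓝 (parts f f' (fun t => B t ω) a b)) := by
  filter_upwards [hB.cont] with ω hω
  exact tendsto_stieltjesSum hab hf hf' hω.continuousOn

lemma aemeasurable_parts (hB : IsStandardWiener P B) {f f' : ℝ → ℝ} {a b : ℝ} (hab : a ≤ b)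
    (hf : ∀ s ∈ Icc a b, HasDerivAt f (f' s) s) (hf' : ContinuousOn f' (Icc a b)) :
    AEMeasurable (fun ω => parts f f' (fun t => B t ω) a b) P :=
  aemeasurable_of_tendsto_metrizable_ae atTop
    (fun n => (measurable_stieltjesSum hB f a b n).aemeasurable) (ae_tendsto_stieltjesSum hB hab hf hf')

lemma integral_mul_exp_parts [IsProbabilityMeasure P] (hB : IsStandardWiener P B) {f f' : ℝ → ℝ}
    {a b : ℝ} (ha : 0 ≤ a)
    (hab : a ≤ b) (hf : ∀ s ∈ Icc a b, HasDerivAt f (f' s) s) (hf' : ContinuousOn f' (Icc a b))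
    {φ : ℕ → Ω → ℂ} {ψ : Ω → ℂ} (hφ : ∀ n, Measurable[past B a] (φ n))
    (hφ1 : ∀ n ω, ‖φ n ω‖ ≤ 1) (hφψ : ∀ᵐ ω ∂P, Tendsto (fun n => φ n ω) atTop (𝓝 (ψ ω)))
    (u : ℝ) :
    ∫ ω, ψ ω * Complex.exp (Complex.I * ((u * parts f f' (fun t => B t ω) a b : ℝ) : ℂ)) ∂P
      = (∫ ω, ψ ω ∂P) * Complex.exp (-((u ^ 2 * ∫ s in a..b, f s ^ 2 : ℝ) : ℂ) / 2) := by
  have hφ' : ∀ n, Measurable (φ n) := fun n => (hφ n).mono (past_le hB.meas a) le_rfl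
  have h1 := tendsto_integral_mul_exp (P := P) hφ' hφ1 hφψ
    (S := fun n ω => u * stieltjesSum f (fun t => B t ω) a b n)
    (W := fun ω => u * parts f f' (fun t => B t ω) a b)
    (fun n => (measurable_stieltjesSum hB f a b n).const_mul u)
    (by
      filter_upwards [ae_tendsto_stieltjesSum hB hab hf hf'] with ω hω
      exact hω.const_mul u)
  have h2 := tendsto_integral_mul_exp (P := P) hφ' hφ1 hφψ
    (S := fun _ _ => 0) (W := fun _ => 0) (fun n => measurable_const)
    (ae_of_all _ fun ω => tendsto_const_nhds)
  simp only [Complex.ofReal_zero, mul_zero, Complex.exp_zero, mul_one] at h2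
  refine tendsto_nhds_unique h1 ?_
  have h3 : ∀ n, ∫ ω, φ n ω * Complex.exp (Complex.I *
      ((u * stieltjesSum f (fun t => B t ω) a b n : ℝ) : ℂ)) ∂P
      = (∫ ω, φ n ω ∂P) * Complex.exp (-((u ^ 2 * ∑ i ∈ Finset.range n, f (gridPoint a b n i) ^ 2 *
      (gridPoint a b n (i + 1) - gridPoint a b n i) : ℝ) : ℂ) / 2) := by
    intro n
    have := hB.integral_mul_sum (fun i => u * f (gridPoint a b n i)) (gridPoint a b n)
      (gridPoint_mono hab n) (by rwa [gridPoint_zero]) (φ := φ n)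
      (by rw [gridPoint_zero]; exact hφ n) n
    simp only [mul_assoc, mul_pow, ← Finset.mul_sum] at this
    exact this
  simp only [h3]
  refine h2.mul ?_
  refine Tendsto.comp (y := 𝓝 (u ^ 2 * ∫ s in a..b, f s ^ 2 : ℝ))
    (g := fun v : ℝ => Complex.exp (-(v : ℂ) / 2)) ?_ ((tendsto_sum_sq hab hf hf').const_mul _)
  exact Continuous.tendsto (by fun_prop) _

/-- The Wiener integral `∫ₐᵇ f dB` is centred Gaussian with variance `∫ₐᵇ f²`. -/
lemma map_parts [IsProbabilityMeasure P] (hB : IsStandardWiener P B) {f f' : ℝ → ℝ} {a b : ℝ}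
    (ha : 0 ≤ a)
    (hab : a ≤ b) (hf : ∀ s ∈ Icc a b, HasDerivAt f (f' s) s) (hf' : ContinuousOn f' (Icc a b)) :
    P.map (fun ω => parts f f' (fun t => B t ω) a b)
      = gaussianReal 0 (Real.toNNReal (∫ s in a..b, f s ^ 2)) := by
  have hm := aemeasurable_parts hB hab hf hf'
  have := Measure.isProbabilityMeasure_map hm
  refine Measure.ext_of_charFun (funext fun u => ?_)
  rw [charFun_gaussianReal, charFun_apply_real, integral_map hm (by fun_prop)]
  have h := integral_mul_exp_parts hB ha hab hf hf' (φ := fun _ _ => 1) (ψ := fun _ => 1)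
    (fun _ => measurable_const) (by simp) (by simp) u
  simp only [one_mul, integral_const, probReal_univ, one_smul] at h
  rw [show (fun ω => Complex.exp (u * ((parts f f' (fun t => B t ω) a b : ℝ) : ℂ) * Complex.I))
    = fun ω => Complex.exp (Complex.I * ((u * parts f f' (fun t => B t ω) a b : ℝ) : ℂ)) by
      ext ω; push_cast; ring_nf, h,
    Real.coe_toNNReal _ (intervalIntegral.integral_nonneg hab fun _ _ => sq_nonneg _)]
  push_cast
  ring_nf

/-- Wiener integrals over non-overlapping intervals are independent. -/
lemma indepFun_parts [IsProbabilityMeasure P] (hB : IsStandardWiener P B) {f f' : ℝ → ℝ}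
    {a b c d : ℝ} (ha : 0 ≤ a)
    (hab : a ≤ b) (hbc : b ≤ c) (hcd : c ≤ d)
    (hf : ∀ s ∈ Icc a d, HasDerivAt f (f' s) s) (hf' : ContinuousOn f' (Icc a d)) :
    IndepFun (fun ω => parts f f' (fun t => B t ω) a b)
      (fun ω => parts f f' (fun t => B t ω) c d) P := by
  have hs1 : Icc a b ⊆ Icc a d := Icc_subset_Icc le_rfl (by linarith)
  have hs2 : Icc c d ⊆ Icc a d := Icc_subset_Icc (by linarith) le_rfl
  have hm1 := aemeasurable_parts hB hab (fun s hs => hf s (hs1 hs)) (hf'.mono hs1)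
  have hm2 := aemeasurable_parts hB hcd (fun s hs => hf s (hs2 hs)) (hf'.mono hs2)
  rw [indepFun_iff_charFun_prod hm1 hm2]
  intro t
  rw [charFun_apply, charFun_apply_real, integral_map (by fun_prop) (by fun_prop),
    integral_map hm1 (by fun_prop),
    map_parts hB (by linarith) hcd (fun s hs => hf s (hs2 hs)) (hf'.mono hs2), charFun_gaussianReal]
  have h := integral_mul_exp_parts hB (by linarith : 0 ≤ c) hcd (fun s hs => hf s (hs2 hs))
    (hf'.mono hs2)
    (φ := fun n ω => Complex.exp (((t.ofLp.1 * stieltjesSum f (fun t => B t ω) a b n : ℝ) : ℂ)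
      * Complex.I))
    (ψ := fun ω => Complex.exp (((t.ofLp.1 * parts f f' (fun t => B t ω) a b : ℝ) : ℂ)
      * Complex.I)) (fun n => by
        have := (measurable_past_stieltjesSum B f ha hab n).mono (past_mono B hbc) le_rfl
        exact Complex.measurable_exp.comp ((Complex.measurable_ofReal.comp
          (this.const_mul _)).mul_const _))
    (fun n ω => (Complex.norm_exp_ofReal_mul_I _).le)
    (by
      filter_upwards [ae_tendsto_stieltjesSum hB hab (fun s hs => hf s (hs1 hs)) (hf'.mono hs1)]
        with ω hω
      exact (Continuous.tendsto (by fun_prop : Continuous fun y : ℝ =>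
        Complex.exp (((t.ofLp.1 * y : ℝ) : ℂ) * Complex.I)) _).comp hω) t.ofLp.2
  convert h using 1
  · refine integral_congr_ae (ae_of_all _ fun ω => ?_)
    simp only [WithLp.prod_inner_apply]
    rw [← Complex.exp_add]
    simp
    ring_nf
  · congr 1
    · simp
    · rw [Real.coe_toNNReal _ (intervalIntegral.integral_nonneg hcd fun _ _ => sq_nonneg _)]
      push_cast
      ring_nf

end Wiener

section Evaluation

lemma supDist_lt_iff {T : ℝ} (hT : 0 < T) (x y : ContPathIcc T) (r : ℝ) :
    supDist T x.1 y.1 < r ↔ ∀ s ∈ Icc 0 T, |x.1 s - y.1 s| < r := by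
  have hne : (Icc (0 : ℝ) T).Nonempty := ⟨0, le_rfl, hT.le⟩
  have hc : ContinuousOn (fun s => |x.1 s - y.1 s|) (Icc 0 T) := (x.2.sub y.2).abs
  unfold supDist
  rw [isCompact_Icc.sSup_lt_iff_of_continuous hne hc]

/-- A tent of height `h` and slope `m` at `t`. -/
def tent (T h m t : ℝ) : ContPathIcc T :=
  ⟨fun s => h * max 0 (1 - m * |s - t|), Continuous.continuousOn (by fun_prop)⟩

/-- A half-space of `C[0,T]` is a countable union of balls centred at tents. -/
lemma setOf_lt_eval_eq {T : ℝ} (hT : 0 < T) {t : ℝ} (ht : t ∈ Icc 0 T) (c : ℝ) :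
    {y : ContPathIcc T | c < y.1 t} = ⋃ n : {n : ℕ // 0 ≤ c + n}, ⋃ m : ℕ,
      {y : ContPathIcc T | supDist T (tent T (c + n) m t).1 y.1 < (n : ℕ)} := by
  ext y
  simp only [mem_iUnion, mem_ofPred_eq, supDist_lt_iff hT]
  constructor
  · intro hy
    obtain ⟨K, hK⟩ := isCompact_Icc.exists_bound_of_continuousOn y.2
    obtain ⟨δ, hδ, hδy⟩ := Metric.continuousOn_iff.1 y.2 t ht (y.1 t - c) (by linarith)
    obtain ⟨n, hn⟩ := exists_nat_gt (max K (-c))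
    obtain ⟨m, hm⟩ := exists_nat_gt (1 / δ)
    have hKn : K < n := (le_max_left _ _).trans_lt hn
    have hcn : -c < n := (le_max_right _ _).trans_lt hn
    refine ⟨⟨n, by linarith⟩, m, fun s hs => ?_⟩
    have hyK := abs_le.1 (hK s hs)
    simp only [tent]
    rw [abs_lt]
    rcases le_or_gt (1 - m * |s - t|) 0 with h | h
    · rw [max_eq_left h]
      constructor <;> linarith [hyK.1, hyK.2]
    · rw [max_eq_right h.le]
      have hm0 : 0 < (m : ℝ) := lt_trans (by positivity) hm
      have hst : dist s t < δ := by
        rw [Real.dist_eq]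
        rw [div_lt_iff₀ hδ] at hm
        by_contra hcon
        have : m * δ ≤ m * |s - t| := mul_le_mul_of_nonneg_left (not_lt.1 hcon) hm0.le
        linarith
      have h1 := hδy s hs hst
      rw [Real.dist_eq, abs_lt] at h1
      have h2 : 0 ≤ (m : ℝ) * |s - t| := by positivity
      have h3 : 0 ≤ (c + n) * (1 - m * |s - t|) := mul_nonneg (by linarith) h.le
      have h4 : (c + n) * (1 - m * |s - t|) ≤ c + n := by
        nlinarith [mul_nonneg (by linarith : 0 ≤ c + n) h2]
      constructor <;> linarith [hyK.1, hyK.2, h1.1]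
  · rintro ⟨⟨n, hn⟩, m, h⟩
    have := abs_lt.1 (h t ht)
    simp [tent] at this
    linarith [this.2]

lemma measurable_eval {T : ℝ} (hT : 0 < T) {t : ℝ} (ht : t ∈ Icc 0 T) :
    Measurable[borelSup T] fun y : ContPathIcc T => y.1 t := by
  let _ : MeasurableSpace (ContPathIcc T) := borelSup T
  refine measurable_of_Ioi fun c => ?_
  change MeasurableSet[borelSup T] {y : ContPathIcc T | c < y.1 t}
  rw [setOf_lt_eval_eq hT ht c]
  refine @MeasurableSet.iUnion _ _ (borelSup T) _ _ fun n =>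
    @MeasurableSet.iUnion _ _ (borelSup T) _ _ fun m => ?_
  exact MeasurableSpace.measurableSet_generateFrom ⟨_, _, rfl⟩

end Evaluation

section Bridge

/-- The kernel `s ↦ (T - s)^{-α}` whose Wiener integral drives the bridge. -/
def bridgeKernel (T α s : ℝ) : ℝ := (T - s) ^ (-α)

/-- The derivative of `bridgeKernel`. -/
def bridgeKernelDeriv (T α s : ℝ) : ℝ := α * (T - s) ^ (-α - 1)

lemma hasDerivAt_bridgeKernel {T s : ℝ} (α : ℝ) (hs : s < T) :
    HasDerivAt (bridgeKernel T α) (bridgeKernelDeriv T α s) s := by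
  have h := ((hasDerivAt_id s).const_sub T).rpow_const (p := -α) (Or.inl (by simp; linarith))
  simp only [id] at h
  refine h.congr_deriv ?_
  unfold bridgeKernelDeriv
  ring

lemma continuousOn_bridgeKernelDeriv (T α : ℝ) : ContinuousOn (bridgeKernelDeriv T α) (Iio T) := by
  intro s hs
  have h : T - s ≠ 0 := by have := mem_Iio.1 hs; linarith
  refine ContinuousAt.continuousWithinAt ?_
  unfold bridgeKernelDeriv
  exact (continuousAt_const.sub continuousAt_id).rpow_const (Or.inl h) |>.const_mul α

lemma bridgeKernel_hyps {T α a b : ℝ} (hb : b < T) :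
    (∀ s ∈ Icc a b, HasDerivAt (bridgeKernel T α) (bridgeKernelDeriv T α s) s) ∧
      ContinuousOn (bridgeKernelDeriv T α) (Icc a b) :=
  ⟨fun _ hs => hasDerivAt_bridgeKernel α (hs.2.trans_lt hb),
    (continuousOn_bridgeKernelDeriv T α).mono fun _ hs => hs.2.trans_lt hb⟩

lemma alphaWienerBridge_eq_parts {T α t : ℝ} (ht0 : 0 ≤ t) (ht : t < T) {Ω₀ : Type*}
    {B : ℝ → Ω₀ → ℝ} {ω : Ω₀}
    (h0 : B 0 ω = 0) :
    alphaWienerBridge T α B t ω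
      = (T - t) ^ α * parts (bridgeKernel T α) (bridgeKernelDeriv T α) (fun s => B s ω) 0 t := by
  have h1 : (T - t) ^ α * (T - t) ^ (-α) = 1 := by
    rw [← Real.rpow_add (by linarith)]
    simp
  unfold alphaWienerBridge parts bridgeKernel bridgeKernelDeriv
  rw [intervalIntegral.integral_of_le ht0]
  simp_rw [h0, mul_assoc]
  rw [integral_const_mul]
  linear_combination (-B t ω) * h1

lemma parts_add_parts {f f' x : ℝ → ℝ} {a b c : ℝ} (hab : a ≤ b) (hbc : b ≤ c)
    (hf' : ContinuousOn f' (Icc a c)) (hx : ContinuousOn x (Icc a c)) :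
    parts f f' x a b + parts f f' x b c = parts f f' x a c := by
  have h := intervalIntegral.integral_add_adjacent_intervals (μ := volume)
    (f := fun s => f' s * x s) (a := a) (b := b) (c := c)
    (((hf'.mul hx).mono (by rw [uIcc_of_le hab]; exact Icc_subset_Icc le_rfl hbc)).intervalIntegrable)
    (((hf'.mul hx).mono (by rw [uIcc_of_le hbc]; exact Icc_subset_Icc hab le_rfl)).intervalIntegrable)
  unfold parts
  linarith

lemma continuousOn_alphaWienerBridge {T α : ℝ} {Ω₀ : Type*} {B : ℝ → Ω₀ → ℝ} {ω : Ω₀}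
    (hω : Continuous fun t => B t ω) :
    ContinuousOn (fun t => alphaWienerBridge T α B t ω) (Ico 0 T) := by
  intro t ht
  obtain ⟨b, htb, hbT⟩ := exists_between ht.2
  have hint : IntegrableOn (fun s => (T - s) ^ (-α - 1) * B s ω) (Icc 0 b) := by
    refine ContinuousOn.integrableOn_Icc fun s hs => ContinuousAt.continuousWithinAt ?_
    have : T - s ≠ 0 := by linarith [hs.2]
    exact ((continuousAt_const.sub continuousAt_id).rpow_const (Or.inl this)).mul hω.continuousAt
  have h1 := intervalIntegral.continuousOn_primitive hint t ⟨ht.1, htb.le⟩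
  have h2 : ContinuousWithinAt
      (fun t => ∫ s in Set.Ioc (0:ℝ) t, (T - s) ^ (-α - 1) * B s ω) (Ico 0 T) t :=
    h1.mono_of_mem_nhdsWithin (by
      filter_upwards [self_mem_nhdsWithin, nhdsWithin_le_nhds (Iio_mem_nhds htb)] with s hs hs'
      exact ⟨hs.1, (mem_Iio.1 hs').le⟩)
  have h3 : T - t ≠ 0 := by linarith [ht.2]
  unfold alphaWienerBridge
  refine hω.continuousWithinAt.sub (ContinuousWithinAt.mul ?_ h2)
  exact (((continuousAt_const.sub continuousAt_id).rpow_const (Or.inl h3)).const_mul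
    α).continuousWithinAt

lemma integral_bridgeKernelDeriv {T t : ℝ} (α : ℝ) (ht0 : 0 ≤ t) (ht : t < T) :
    ∫ s in (0 : ℝ)..t, bridgeKernelDeriv T α s = (T - t) ^ (-α) - T ^ (-α) := by
  have h := bridgeKernel_hyps (α := α) (a := 0) ht
  rw [intervalIntegral.integral_eq_sub_of_hasDerivAt (f := bridgeKernel T α)
    (fun s hs => h.1 s (by rwa [uIcc_of_le ht0] at hs))
    (by apply ContinuousOn.intervalIntegrable; rw [uIcc_of_le ht0]; exact h.2)]
  simp [bridgeKernel]

lemma tendsto_rpow_sub {T α : ℝ} (hα : 0 < α) :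
    Tendsto (fun t => (T - t) ^ α) (𝓝[<] T) (𝓝 0) := by
  have : ContinuousAt (fun t => (T - t) ^ α) T :=
    (continuousAt_const.sub continuousAt_id).rpow_const (Or.inr hα.le)
  have h2 := this.tendsto
  simp only [sub_self, Real.zero_rpow hα.ne'] at h2
  exact h2.mono_left nhdsWithin_le_nhds

lemma tendsto_bridge_average {T α : ℝ} (hT : 0 < T) (hα : 0 < α) {x : ℝ → ℝ} (hx : Continuous x) :
    Tendsto (fun t => (T - t) ^ α * ∫ s in (0 : ℝ)..t, bridgeKernelDeriv T α s * x s) (𝓝[<] T)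
      (𝓝 (x T)) := by
  have hcont : ∀ {a b : ℝ}, a ≤ b → b < T → ∀ {y : ℝ → ℝ}, Continuous y →
      IntervalIntegrable (fun s => bridgeKernelDeriv T α s * y s) volume a b := by
    intro a b hab hb y hy
    apply ContinuousOn.intervalIntegrable
    rw [uIcc_of_le hab]
    exact (bridgeKernel_hyps hb).2.mul hy.continuousOn
  have hnn : ∀ s < T, 0 ≤ bridgeKernelDeriv T α s := fun s hs =>
    mul_nonneg hα.le (Real.rpow_nonneg (by linarith) _)
  have hone : ∀ t, t < T → (T - t) ^ α * (T - t) ^ (-α) = 1 := fun t ht => by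
    rw [← Real.rpow_add (by linarith)]
    simp
  rw [Metric.tendsto_nhds]
  intro ε hε
  obtain ⟨δ, hδ, hδx⟩ := Metric.continuous_iff.1 hx T (ε / 3) (by linarith)
  set a := max 0 (T - δ) with ha
  have ha0 : 0 ≤ a := le_max_left _ _
  have haT : a < T := max_lt hT (by linarith)
  set K := ∫ s in (0 : ℝ)..a, bridgeKernelDeriv T α s * (x s - x T) with hK
  have hlim := tendsto_rpow_sub (T := T) hα
  have hl1 : Tendsto (fun t => (T - t) ^ α * |K|) (𝓝[<] T) (𝓝 0) := by
    simpa using hlim.mul_const |K|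
  have hl2 : Tendsto (fun t => (T - t) ^ α * (T ^ (-α) * |x T|)) (𝓝[<] T) (𝓝 0) := by
    simpa using hlim.mul_const (T ^ (-α) * |x T|)
  filter_upwards [hl1.eventually (gt_mem_nhds (show (0 : ℝ) < ε / 3 by linarith)),
    hl2.eventually (gt_mem_nhds (show (0 : ℝ) < ε / 3 by linarith)),
    self_mem_nhdsWithin, nhdsWithin_le_nhds (Ioi_mem_nhds haT)] with t h1 h2 ht hat
  have ht : t < T := ht
  have hat : a < t := hat
  have hp : 0 ≤ (T - t) ^ α := Real.rpow_nonneg (by linarith) _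
  have hsplit : ∫ s in (0 : ℝ)..t, bridgeKernelDeriv T α s * x s
      = K + (∫ s in a..t, bridgeKernelDeriv T α s * (x s - x T))
        + ((T - t) ^ (-α) - T ^ (-α)) * x T := by
    have hx' : Continuous fun s => x s - x T := hx.sub continuous_const
    rw [hK, intervalIntegral.integral_add_adjacent_intervals
      (hcont ha0 haT hx') (hcont hat.le ht hx'),
      ← integral_bridgeKernelDeriv α (ha0.trans hat.le) ht, ← intervalIntegral.integral_mul_const,
      ← intervalIntegral.integral_add (hcont (ha0.trans hat.le) ht hx')
        (hcont (ha0.trans hat.le) ht continuous_const)]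
    congr 1
    ext s
    ring
  have hmid : |∫ s in a..t, bridgeKernelDeriv T α s * (x s - x T)| ≤ (T - t) ^ (-α) * (ε / 3) := by
    have hb : |∫ s in a..t, bridgeKernelDeriv T α s * (x s - x T)|
        ≤ ∫ s in a..t, bridgeKernelDeriv T α s * (ε / 3) := by
      rw [← Real.norm_eq_abs]
      refine intervalIntegral.norm_integral_le_of_norm_le hat.le ?_ (hcont hat.le ht continuous_const)
      refine ae_of_all _ fun s hs => ?_
      have hsT : s < T := hs.2.trans_lt ht
      rw [norm_mul, Real.norm_of_nonneg (hnn s hsT)]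
      refine mul_le_mul_of_nonneg_left ?_ (hnn s hsT)
      have : T - δ ≤ a := le_max_right _ _
      have := hδx s (by rw [Real.dist_eq, abs_lt]; constructor <;> linarith [hs.1])
      rw [dist_eq_norm] at this
      exact this.le
    have hc : ∫ s in a..t, bridgeKernelDeriv T α s * (ε / 3)
        ≤ ∫ s in (0 : ℝ)..t, bridgeKernelDeriv T α s * (ε / 3) := by
      have h3 := intervalIntegral.integral_add_adjacent_intervals
        (hcont ha0 haT (continuous_const (y := ε / 3)))
        (hcont hat.le ht (continuous_const (y := ε / 3)))
      have h4 : 0 ≤ ∫ s in (0 : ℝ)..a, bridgeKernelDeriv T α s * (ε / 3) :=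
        intervalIntegral.integral_nonneg ha0 fun s hs =>
          mul_nonneg (hnn s (hs.2.trans_lt haT)) (by linarith)
      linarith
    rw [intervalIntegral.integral_mul_const (a := 0) (b := t),
      integral_bridgeKernelDeriv α (ha0.trans hat.le) ht] at hc
    have : 0 ≤ T ^ (-α) := Real.rpow_nonneg hT.le _
    nlinarith
  have hmid' : (T - t) ^ α * |∫ s in a..t, bridgeKernelDeriv T α s * (x s - x T)| ≤ ε / 3 := by
    calc _ ≤ (T - t) ^ α * ((T - t) ^ (-α) * (ε / 3)) := mul_le_mul_of_nonneg_left hmid hp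
      _ = ε / 3 := by rw [← mul_assoc, hone t ht, one_mul]
  rw [Real.dist_eq, hsplit]
  have heq : (T - t) ^ α * (K + (∫ s in a..t, bridgeKernelDeriv T α s * (x s - x T))
        + ((T - t) ^ (-α) - T ^ (-α)) * x T) - x T
      = (T - t) ^ α * K + (T - t) ^ α * (∫ s in a..t, bridgeKernelDeriv T α s * (x s - x T))
        - (T - t) ^ α * (T ^ (-α) * x T) := by
    linear_combination (x T) * hone t ht
  rw [heq]
  have e1 : |(T - t) ^ α * K| = (T - t) ^ α * |K| := by rw [abs_mul, abs_of_nonneg hp]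
  have e2 := abs_mul ((T - t) ^ α) (∫ s in a..t, bridgeKernelDeriv T α s * (x s - x T))
  rw [abs_of_nonneg hp] at e2
  have e3 : |(T - t) ^ α * (T ^ (-α) * x T)| = (T - t) ^ α * (T ^ (-α) * |x T|) := by
    rw [abs_mul, abs_mul, abs_of_nonneg hp, abs_of_nonneg (Real.rpow_nonneg hT.le _)]
  have t1 := abs_sub ((T - t) ^ α * K
    + (T - t) ^ α * (∫ s in a..t, bridgeKernelDeriv T α s * (x s - x T)))
    ((T - t) ^ α * (T ^ (-α) * x T))
  have t2 := abs_add_le ((T - t) ^ α * K)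
    ((T - t) ^ α * (∫ s in a..t, bridgeKernelDeriv T α s * (x s - x T)))
  linarith

lemma continuousOn_bridgeExtensionFull {T α : ℝ} (hT : 0 < T) (hα : 0 ≤ α) {Ω₀ : Type*}
    {B : ℝ → Ω₀ → ℝ} {ω : Ω₀}
    (hω : Continuous fun t => B t ω) :
    ContinuousOn (fun t => bridgeExtensionFull T α B t ω) (Icc 0 T) := by
  rcases hα.eq_or_lt with rfl | hα
  · have : (fun t => bridgeExtensionFull T 0 B t ω) = fun t => if t < T then B t ω else B T ω := by
      ext t
      simp [bridgeExtensionFull, alphaWienerBridge]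
    rw [this]
    refine ContinuousOn.congr hω.continuousOn fun t ht => ?_
    split_ifs with h
    · rfl
    · rw [le_antisymm ht.2 (not_lt.1 h)]
  · intro t ht
    rcases ht.2.lt_or_eq with htT | rfl
    · have h1 := continuousOn_alphaWienerBridge (T := T) (α := α) hω t ⟨ht.1, htT⟩
      have h2 : ContinuousWithinAt (fun t => alphaWienerBridge T α B t ω) (Icc 0 T) t :=
        h1.mono_of_mem_nhdsWithin (by
          filter_upwards [self_mem_nhdsWithin, nhdsWithin_le_nhds (Iio_mem_nhds htT)] with s hs hs'
          exact ⟨hs.1, hs'⟩)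
      refine h2.congr_of_eventuallyEq ?_ (by simp [bridgeExtensionFull, htT])
      filter_upwards [nhdsWithin_le_nhds (Iio_mem_nhds htT)] with s hs
      simp [bridgeExtensionFull, mem_Iio.1 hs]
    · have hval : bridgeExtensionFull t α B t ω = 0 := by simp [bridgeExtensionFull, hα.ne']
      have hlim : Tendsto (fun s => alphaWienerBridge t α B s ω) (𝓝[Ico 0 t] t) (𝓝 0) := by
        have h1 := (hω.tendsto t).mono_left (nhdsWithin_le_nhds (s := Iio t))
        have h2 := h1.sub (tendsto_bridge_average hT hα hω)
        rw [sub_self] at h2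
        refine (h2.mono_left (nhdsWithin_mono _ fun s hs => hs.2)).congr' ?_
        filter_upwards [self_mem_nhdsWithin] with s hs
        unfold alphaWienerBridge bridgeKernelDeriv
        rw [intervalIntegral.integral_of_le hs.1]
        simp_rw [mul_assoc]
        rw [integral_const_mul]
        ring
      have hset : Icc 0 t = insert t (Ico 0 t) := by
        ext s; simp only [mem_Icc, mem_insert_iff, mem_Ico]
        constructor
        · rintro ⟨h1, h2⟩
          rcases h2.lt_or_eq with h | h
          · exact Or.inr ⟨h1, h⟩
          · exact Or.inl h
        · rintro (h | h)
          · subst h; exact ⟨hT.le, le_rfl⟩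
          · exact ⟨h.1, h.2.le⟩
      rw [hset, continuousWithinAt_insert_self]
      have hlim' : Tendsto (fun s => alphaWienerBridge t α B s ω) (𝓝[Ico 0 t] t)
          (𝓝 (bridgeExtensionFull t α B t ω)) := by rwa [hval]
      refine hlim'.congr' ?_
      filter_upwards [self_mem_nhdsWithin] with s hs
      simp [bridgeExtensionFull, hs.2]

lemma extBridgePath_apply {T α t : ℝ} (hT : 0 < T) (hα : 0 ≤ α) {Ω₀ : Type*} {B : ℝ → Ω₀ → ℝ}
    {ω : Ω₀}
    (hω : Continuous fun t => B t ω) (h0 : B 0 ω = 0) (ht0 : 0 ≤ t) (ht : t < T) :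
    (extBridgePath T α B ω).1 t = (T - t) ^ α *
      parts (bridgeKernel T α) (bridgeKernelDeriv T α) (fun s => B s ω) 0 t := by
  rw [← alphaWienerBridge_eq_parts ht0 ht h0]
  have h : extBridgePath T α B ω = ⟨fun t => bridgeExtensionFull T α B t ω,
      continuousOn_bridgeExtensionFull hT hα hω⟩ :=
    dif_pos (continuousOn_bridgeExtensionFull hT hα hω)
  rw [h]
  simp [bridgeExtensionFull, ht]

end Bridge

section Gaussian

variable {P : Measure Ω}

lemma lintegral_sq_gaussianReal (v : ℝ≥0) :
    ∫⁻ x, ENNReal.ofReal (x ^ 2) ∂(gaussianReal 0 v) = v := by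
  have hm : MemLp (fun x : ℝ => x) 2 (gaussianReal 0 v) := memLp_id_gaussianReal 2
  have h := variance_fun_id_gaussianReal (μ := 0) (v := v)
  rw [variance_eq_integral (by fun_prop)] at h
  simp only [integral_id_gaussianReal, sub_zero] at h
  rw [← ofReal_integral_eq_lintegral_ofReal hm.integrable_sq (ae_of_all _ fun x => sq_nonneg x), h,
    ENNReal.ofReal_coe_nnreal]

/-- Centred Gaussian variables with summable variances converge to `0` almost surely. -/
lemma ae_tendsto_zero_of_gaussian {G : ℕ → Ω → ℝ} (hG : ∀ n, AEMeasurable (G n) P)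
    {v : ℕ → ℝ} (hlaw : ∀ n, P.map (G n) = gaussianReal 0 (Real.toNNReal (v n)))
    {w : ℕ → ℝ} (hvw : ∀ n, v n ≤ w n) (hw : Summable w) :
    ∀ᵐ ω ∂P, Tendsto (fun n => G n ω) atTop (𝓝 0) := by
  have h1 : ∀ n, ∫⁻ ω, ENNReal.ofReal (G n ω ^ 2) ∂P = ENNReal.ofReal (v n) := by
    intro n
    have := lintegral_sq_gaussianReal (Real.toNNReal (v n))
    rwa [← hlaw n, lintegral_map' (by fun_prop) (hG n)] at this
  have h2 : ∫⁻ ω, ∑' n, ENNReal.ofReal (G n ω ^ 2) ∂P ≠ ∞ := by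
    rw [lintegral_tsum fun n => ((hG n).pow_const 2).ennreal_ofReal]
    simp_rw [h1]
    refine ne_top_of_le_ne_top hw.tsum_ofReal_ne_top ?_
    exact ENNReal.tsum_le_tsum fun n => ENNReal.ofReal_le_ofReal (hvw n)
  have h3 := ae_lt_top' (AEMeasurable.tsum
    fun n => ((hG n).pow_const 2).ennreal_ofReal) h2
  filter_upwards [h3] with ω hω
  have h4 := ENNReal.tendsto_atTop_zero_of_tsum_ne_top hω.ne
  have h5 := (ENNReal.tendsto_toReal ENNReal.zero_ne_top).comp h4
  simp only [Function.comp_def, ENNReal.toReal_zero, ENNReal.toReal_ofReal (sq_nonneg _)] at h5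
  have h6 := h5.sqrt
  simp only [Real.sqrt_sq_eq_abs, Real.sqrt_zero] at h6
  exact (tendsto_zero_iff_abs_tendsto_zero _).2 h6

lemma gaussianReal_Ioo_le {v : ℝ} (hv : 0 < v) :
    gaussianReal 0 (Real.toNNReal v) (Ioo (-1) 1) ≤ ENNReal.ofReal (1 / √v) := by
  rw [gaussianReal_apply _ (by simpa using hv)]
  have hpdf : ∀ x, gaussianPDF 0 (Real.toNNReal v) x ≤ ENNReal.ofReal (1 / (2 * √v)) := by
    intro x
    refine ENNReal.ofReal_le_ofReal ?_
    rw [gaussianPDFReal_def, Real.coe_toNNReal _ hv.le]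
    have h1 : Real.exp (-(x - 0) ^ 2 / (2 * v)) ≤ 1 := by
      rw [Real.exp_le_one_iff]
      exact div_nonpos_of_nonpos_of_nonneg (neg_nonpos.2 (sq_nonneg _)) (by positivity)
    have h2 : 2 * √v ≤ √(2 * Real.pi * v) := by
      refine Real.le_sqrt_of_sq_le ?_
      rw [mul_pow, Real.sq_sqrt hv.le]
      nlinarith [Real.pi_gt_three]
    have h3 : 0 < 2 * √v := by positivity
    calc _ ≤ (√(2 * Real.pi * v))⁻¹ * 1 := mul_le_mul_of_nonneg_left h1 (by positivity)
      _ ≤ 1 / (2 * √v) := by rw [mul_one, ← one_div]; exact one_div_le_one_div_of_le h3 h2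
  calc _ ≤ ∫⁻ _ in Ioo (-1 : ℝ) 1, ENNReal.ofReal (1 / (2 * √v)) :=
        lintegral_mono fun x => hpdf x
    _ = ENNReal.ofReal (1 / √v) := by
      rw [lintegral_const, Measure.restrict_apply_univ, Real.volume_Ioo,
        ← ENNReal.ofReal_mul (by positivity)]
      congr 1
      field_simp
      norm_num

/-- Centred Gaussian variables whose standard deviations have summable inverses do not converge to
`0`, almost surely. -/
lemma ae_not_tendsto_zero_of_gaussian {G : ℕ → Ω → ℝ} (hG : ∀ n, AEMeasurable (G n) P)
    {v : ℕ → ℝ} (hv : ∀ n, 0 < v n)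
    (hlaw : ∀ n, P.map (G n) = gaussianReal 0 (Real.toNNReal (v n)))
    (hsum : Summable fun n => 1 / √(v n)) :
    ∀ᵐ ω ∂P, ¬ Tendsto (fun n => G n ω) atTop (𝓝 0) := by
  have h1 : ∑' n, P (G n ⁻¹' Ioo (-1) 1) ≠ ∞ := by
    refine ne_top_of_le_ne_top hsum.tsum_ofReal_ne_top (ENNReal.tsum_le_tsum fun n => ?_)
    rw [← Measure.map_apply_of_aemeasurable (hG n) measurableSet_Ioo, hlaw n]
    exact gaussianReal_Ioo_le (hv n)
  filter_upwards [ae_eventually_notMem h1] with ω hω hcon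
  have h2 := hcon.eventually (Ioo_mem_nhds (by norm_num : (-1 : ℝ) < 0) one_pos)
  obtain ⟨n, hn, hn'⟩ := (hω.and h2).exists
  exact hn hn'

lemma integral_cos_gaussianReal {v : ℝ} (hv : 0 ≤ v) :
    ∫ x, Real.cos x ∂(gaussianReal 0 (Real.toNNReal v)) = Real.exp (-v / 2) := by
  have h := charFun_gaussianReal (μ := 0) (v := Real.toNNReal v) 1
  rw [charFun_apply_real] at h
  have hint : Integrable (fun x : ℝ => Complex.exp ((1 : ℝ) * x * Complex.I))
      (gaussianReal 0 (Real.toNNReal v)) := by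
    refine Integrable.mono' (integrable_const (1 : ℝ)) (by fun_prop) (ae_of_all _ fun x => ?_)
    rw [Complex.ofReal_one, one_mul, Complex.norm_exp_ofReal_mul_I]
  have h2 := congrArg Complex.re h
  rw [← RCLike.re_eq_complex_re, ← integral_re hint] at h2
  simp only [Complex.ofReal_one, one_mul, RCLike.re_eq_complex_re, Complex.exp_ofReal_mul_I_re] at h2
  rw [h2, Real.coe_toNNReal _ hv, ← Complex.exp_ofReal_re]
  congr 2
  push_cast
  ring

end Gaussian

section Variance

/-- The Wiener integral of the bridge kernel over `[a,b]`. -/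
def bridgeInt {Ω₀ : Type*} (T α : ℝ) (B : ℝ → Ω₀ → ℝ) (a b : ℝ) (ω : Ω₀) : ℝ :=
  parts (bridgeKernel T α) (bridgeKernelDeriv T α) (fun s => B s ω) a b

lemma bridgeKernel_sq {T α s : ℝ} (hs : s < T) : bridgeKernel T α s ^ 2 = (T - s) ^ (-(2 * α)) := by
  unfold bridgeKernel
  rw [← Real.rpow_natCast, ← Real.rpow_mul (by linarith)]
  congr 1
  push_cast
  ring

variable {P : Measure Ω} {B : ℝ → Ω → ℝ}

lemma aemeasurable_bridgeInt (hB : IsStandardWiener P B) {T α a b : ℝ} (hab : a ≤ b) (hb : b < T) :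
    AEMeasurable (bridgeInt T α B a b) P :=
  aemeasurable_parts hB hab (bridgeKernel_hyps hb).1 (bridgeKernel_hyps hb).2

lemma map_const_mul_bridgeInt [IsProbabilityMeasure P] (hB : IsStandardWiener P B)
    {T α a b : ℝ} (ha : 0 ≤ a) (hab : a ≤ b) (hb : b < T) (c : ℝ) :
    P.map (fun ω => c * bridgeInt T α B a b ω)
      = gaussianReal 0 (Real.toNNReal (c ^ 2 * ∫ s in a..b, bridgeKernel T α s ^ 2)) := by
  have h := map_parts hB ha hab (bridgeKernel_hyps (α := α) hb).1 (bridgeKernel_hyps hb).2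
  have h2 := AEMeasurable.map_map_of_aemeasurable (μ := P) (f := bridgeInt T α B a b)
    (g := fun x => c * x) (by fun_prop) (aemeasurable_bridgeInt hB hab hb)
  change _ = P.map (fun ω => c * bridgeInt T α B a b ω) at h2
  change P.map (bridgeInt T α B a b) = _ at h
  rw [← h2, h, gaussianReal_map_const_mul, mul_zero]
  congr 1
  rw [Real.toNNReal_mul (sq_nonneg c)]
  congr 1
  ext
  simp [sq_nonneg]

lemma indepFun_bridgeInt [IsProbabilityMeasure P] (hB : IsStandardWiener P B)
    {T α a b c d : ℝ} (ha : 0 ≤ a) (hab : a ≤ b) (hbc : b ≤ c) (hcd : c ≤ d) (hd : d < T) :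
    IndepFun (bridgeInt T α B a b) (bridgeInt T α B c d) P :=
  indepFun_parts hB ha hab hbc hcd (bridgeKernel_hyps hd).1 (bridgeKernel_hyps hd).2

lemma ae_extBridgePath_apply (hB : IsStandardWiener P B) {T α : ℝ} (hT : 0 < T) (hα : 0 ≤ α) :
    ∀ᵐ ω ∂P, ∀ t, 0 ≤ t → t < T →
      (extBridgePath T α B ω).1 t = (T - t) ^ α * bridgeInt T α B 0 t ω := by
  filter_upwards [hB.cont, hB.init] with ω h1 h2 t ht0 ht
  exact extBridgePath_apply hT hα h1 h2 ht0 ht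

/-- The variance of the bridge at time `t`. -/
def bridgeVar (T α t : ℝ) : ℝ := ((T - t) ^ α) ^ 2 * ∫ s in (0 : ℝ)..t, bridgeKernel T α s ^ 2

lemma bridgeVar_eq {T t : ℝ} (α : ℝ) (ht0 : 0 ≤ t) (ht : t < T) :
    bridgeVar T α t = ∫ s in (0 : ℝ)..t, ((T - t) / (T - s)) ^ (2 * α) := by
  unfold bridgeVar
  rw [← intervalIntegral.integral_const_mul]
  refine intervalIntegral.integral_congr fun s hs => ?_
  rw [uIcc_of_le ht0] at hs
  have hs' : s < T := hs.2.trans_lt ht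
  rw [bridgeKernel_sq hs', Real.div_rpow (by linarith) (by linarith), Real.rpow_neg (by linarith),
    ← Real.rpow_natCast, ← Real.rpow_mul (by linarith), div_eq_mul_inv, mul_comm α]
  norm_num

lemma continuousOn_ratio_rpow {T t : ℝ} (p : ℝ) (ht : t < T) :
    ContinuousOn (fun s => ((T - t) / (T - s)) ^ p) (Icc 0 t) := by
  intro s hs
  have h1 : T - s ≠ 0 := by linarith [hs.2]
  have h2 : (T - t) / (T - s) ≠ 0 := div_ne_zero (by linarith) h1
  refine ContinuousAt.continuousWithinAt ?_
  exact (continuousAt_const.div (continuousAt_const.sub continuousAt_id) h1).rpow_const (Or.inl h2)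

lemma integral_ratio {T t : ℝ} (ht0 : 0 ≤ t) (ht : t < T) :
    ∫ s in (0 : ℝ)..t, (T - t) / (T - s) = (T - t) * Real.log (T / (T - t)) := by
  have hd : ∀ s ∈ uIcc 0 t,
      HasDerivAt (fun s => -(T - t) * Real.log (T - s)) ((T - t) / (T - s)) s := by
    intro s hs
    rw [uIcc_of_le ht0] at hs
    have h1 : T - s ≠ 0 := by linarith [hs.2]
    refine ((((hasDerivAt_id s).const_sub T).log h1).const_mul (-(T - t))).congr_deriv ?_
    simp only [id]
    ring
  rw [intervalIntegral.integral_eq_sub_of_hasDerivAt hd, Real.log_div (by linarith) (by linarith)]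
  · simp only [sub_zero]
    ring
  · apply ContinuousOn.intervalIntegrable
    rw [uIcc_of_le ht0]
    simpa using continuousOn_ratio_rpow 1 ht

lemma integral_ratio_sq_le {T t : ℝ} (ht0 : 0 ≤ t) (ht : t < T) :
    ∫ s in (0 : ℝ)..t, ((T - t) / (T - s)) ^ 2 ≤ T - t := by
  have hd : ∀ s ∈ uIcc 0 t,
      HasDerivAt (fun s => (T - t) ^ 2 * (T - s)⁻¹) (((T - t) / (T - s)) ^ 2) s := by
    intro s hs
    rw [uIcc_of_le ht0] at hs
    have h1 : T - s ≠ 0 := by linarith [hs.2]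
    refine ((((hasDerivAt_id s).const_sub T).inv h1).const_mul ((T - t) ^ 2)).congr_deriv ?_
    simp only [id]
    field_simp
    try ring
  rw [intervalIntegral.integral_eq_sub_of_hasDerivAt hd]
  · have h1 : T - t ≠ 0 := by linarith
    have h2 : 0 ≤ (T - t) ^ 2 * (T - 0)⁻¹ :=
      mul_nonneg (sq_nonneg _) (inv_nonneg.2 (by linarith))
    have h3 : (T - t) ^ 2 * (T - t)⁻¹ = T - t := by field_simp
    linarith
  · apply ContinuousOn.intervalIntegrable
    rw [uIcc_of_le ht0]
    simpa using continuousOn_ratio_rpow 2 ht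

/-- For `α ≤ 1/2` and `α < β`, the variance of the `β`-bridge is negligible with respect to that of
the `α`-bridge near `T`. -/
lemma exists_bridgeVar_le {T α β η : ℝ} (hT : 0 < T) (hα : 0 ≤ α) (hα2 : α ≤ 1 / 2) (hαβ : α < β)
    (hη : 0 < η) :
    ∃ t, 0 ≤ t ∧ t < T ∧ 0 < bridgeVar T α t ∧ bridgeVar T β t ≤ η * bridgeVar T α t := by
  set ε := η / 2 with hε
  have hε0 : 0 < ε := by positivity
  set e := ε ^ (2 * (β - α))⁻¹ with he
  have he0 : 0 < e := Real.rpow_pos_of_pos hε0 _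
  set C := 1 / e ^ 2 with hC
  have hC0 : 0 < C := by positivity
  set L := C / ε + 1 with hL
  have hL0 : 0 < L := by positivity
  set t := T - T * Real.exp (-L) with ht
  have htT : t < T := by
    have : 0 < T * Real.exp (-L) := by positivity
    linarith
  have hTt : 0 < T - t := by linarith
  have ht0 : 0 ≤ t := by
    have : Real.exp (-L) ≤ 1 := Real.exp_le_one_iff.2 (by linarith)
    have : T * Real.exp (-L) ≤ T * 1 := mul_le_mul_of_nonneg_left this hT.le
    linarith
  have hlog : Real.log (T / (T - t)) = L := by
    have : T / (T - t) = Real.exp L := by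
      rw [ht, sub_sub_cancel, Real.exp_neg]
      field_simp
    rw [this, Real.log_exp]
  have hii : ∀ p : ℝ, IntervalIntegrable (fun s => ((T - t) / (T - s)) ^ p) volume 0 t := by
    intro p
    apply ContinuousOn.intervalIntegrable
    rw [uIcc_of_le ht0]
    exact continuousOn_ratio_rpow p htT
  have hu : ∀ s ∈ Icc 0 t, 0 < (T - t) / (T - s) ∧ (T - t) / (T - s) ≤ 1 := by
    intro s hs
    have : 0 < T - s := by linarith [hs.2]
    exact ⟨by positivity, by rw [div_le_one this]; linarith [hs.2]⟩
  have hlow : (T - t) * L ≤ bridgeVar T α t := by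
    rw [bridgeVar_eq α ht0 htT, ← hlog, ← integral_ratio ht0 htT]
    refine intervalIntegral.integral_mono_on ht0 (by simpa using hii 1) (hii _) fun s hs => ?_
    have := Real.rpow_le_rpow_of_exponent_ge (hu s hs).1 (hu s hs).2 (by linarith : 2 * α ≤ 1)
    simpa using this
  have hup : bridgeVar T β t ≤ ε * bridgeVar T α t + C * (T - t) := by
    have h2 : IntervalIntegrable (fun s => ((T - t) / (T - s)) ^ 2) volume 0 t := by
      simpa using hii 2
    have h1 : bridgeVar T β t ≤ ∫ s in (0 : ℝ)..t,
        (ε * ((T - t) / (T - s)) ^ (2 * α) + C * ((T - t) / (T - s)) ^ 2) := by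
      rw [bridgeVar_eq β ht0 htT]
      refine intervalIntegral.integral_mono_on ht0 (hii _)
        (((hii _).const_mul _).add (h2.const_mul _)) fun s hs => ?_
      obtain ⟨hu0, hu1⟩ := hu s hs
      set u := (T - t) / (T - s)
      have hp : 0 < 2 * (β - α) := by linarith
      rcases le_or_gt u e with hue | hue
      · have h3 : u ^ (2 * (β - α)) ≤ ε := by
          have := Real.rpow_le_rpow hu0.le hue hp.le
          rwa [he, Real.rpow_inv_rpow hε0.le hp.ne'] at this
        have h4 : u ^ (2 * β) = u ^ (2 * (β - α)) * u ^ (2 * α) := by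
          rw [← Real.rpow_add hu0]
          congr 1
          ring
        rw [h4]
        have h5 : 0 ≤ u ^ (2 * α) := Real.rpow_nonneg hu0.le _
        have h6 : 0 ≤ C * u ^ 2 := by positivity
        nlinarith
      · have h3 : u ^ (2 * β) ≤ 1 := Real.rpow_le_one hu0.le hu1 (by linarith)
        have h4 : 1 ≤ C * u ^ 2 := by
          rw [hC, div_mul_eq_mul_div, one_mul, one_le_div (by positivity)]
          exact pow_le_pow_left₀ he0.le hue.le 2
        have h5 : 0 ≤ ε * u ^ (2 * α) := mul_nonneg hε0.le (Real.rpow_nonneg hu0.le _)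
        linarith
    rw [intervalIntegral.integral_add ((hii _).const_mul _) (h2.const_mul _),
      intervalIntegral.integral_const_mul, intervalIntegral.integral_const_mul,
      ← bridgeVar_eq α ht0 htT] at h1
    have := mul_le_mul_of_nonneg_left (integral_ratio_sq_le ht0 htT) hC0.le
    linarith
  refine ⟨t, ht0, htT, lt_of_lt_of_le (by positivity) hlow, hup.trans ?_⟩
  have h1 : C * (T - t) ≤ ε * bridgeVar T α t := by
    have h2 : ε * ((T - t) * L) ≤ ε * bridgeVar T α t := mul_le_mul_of_nonneg_left hlow hε0.le
    have h3 : ε * L = C + ε := by rw [hL]; field_simp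
    nlinarith
  have h4 : η = ε + ε := by rw [hε]; ring
  rw [h4]
  linarith

end Variance

section Singularity

variable {P : Measure Ω} [IsProbabilityMeasure P] {B : ℝ → Ω → ℝ}

lemma gaussian_extBridgePath (hB : IsStandardWiener P B) {T α t : ℝ} (hT : 0 < T) (hα : 0 ≤ α)
    (ht0 : 0 ≤ t) (ht : t < T) (c : ℝ) :
    AEMeasurable (fun ω => c * (extBridgePath T α B ω).1 t) P ∧
      P.map (fun ω => c * (extBridgePath T α B ω).1 t)
        = gaussianReal 0 (Real.toNNReal (c ^ 2 * bridgeVar T α t)) := by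
  have h : (fun ω => c * (T - t) ^ α * bridgeInt T α B 0 t ω)
      =ᵐ[P] fun ω => c * (extBridgePath T α B ω).1 t := by
    filter_upwards [ae_extBridgePath_apply hB hT hα] with ω hω
    rw [hω t ht0 ht, mul_assoc]
  refine ⟨((aemeasurable_bridgeInt hB ht0 ht).const_mul _).congr h, ?_⟩
  rw [← Measure.map_congr h, map_const_mul_bridgeInt hB le_rfl ht0 ht, bridgeVar, mul_pow, mul_assoc]

/-- The laws of the bridges with parameters `α ≤ 1/2` and `β > α` are separated by the decay of the
path along a suitable sequence of times. -/
lemma exists_separating_set_of_le (hB : IsStandardWiener P B) {T α β : ℝ} (hT : 0 < T)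
    (hα : 0 ≤ α) (hα2 : α ≤ 1 / 2) (hαβ : α < β) :
    ∃ S : Set (ContPathIcc T), MeasurableSet[borelSup T] S ∧
      (∀ᵐ ω ∂P, extBridgePath T β B ω ∈ S) ∧ ∀ᵐ ω ∂P, extBridgePath T α B ω ∉ S := by
  choose t ht0 htT hpos hle using fun n : ℕ =>
    exists_bridgeVar_le hT hα hα2 hαβ (η := (1 / 8) ^ n) (by positivity)
  set c : ℕ → ℝ := fun n => 2 ^ n / √(bridgeVar T α (t n)) with hc
  have hc2 : ∀ n, c n ^ 2 = 4 ^ n / bridgeVar T α (t n) := fun n => by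
    rw [hc, div_pow, Real.sq_sqrt (hpos n).le, ← pow_mul, mul_comm n, pow_mul]
    norm_num
  refine ⟨{y | Tendsto (fun n => c n * y.1 (t n)) atTop (𝓝 0)}, ?_, ?_, ?_⟩
  · let _ : MeasurableSpace (ContPathIcc T) := borelSup T
    exact measurableSet_tendsto (𝓝 0) fun n =>
      (measurable_eval hT ⟨ht0 n, (htT n).le⟩).const_mul (c n)
  · have h := fun n => gaussian_extBridgePath hB hT (hα.trans hαβ.le) (ht0 n) (htT n) (c n)
    refine ae_tendsto_zero_of_gaussian (fun n => (h n).1) (fun n => (h n).2)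
      (w := fun n => (1 / 2) ^ n) (fun n => ?_) summable_geometric_two
    calc c n ^ 2 * bridgeVar T β (t n)
        ≤ c n ^ 2 * ((1 / 8) ^ n * bridgeVar T α (t n)) :=
          mul_le_mul_of_nonneg_left (hle n) (sq_nonneg _)
      _ = (4 * (1 / 8)) ^ n := by
          rw [hc2, mul_pow]
          have := (hpos n).ne'
          field_simp
      _ = (1 / 2) ^ n := by norm_num
  · have h := fun n => gaussian_extBridgePath hB hT hα (ht0 n) (htT n) (c n)
    have hv : ∀ n, c n ^ 2 * bridgeVar T α (t n) = 4 ^ n := fun n => by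
      rw [hc2, div_mul_cancel₀ _ (hpos n).ne']
    refine ae_not_tendsto_zero_of_gaussian (fun n => (h n).1) (fun n => ?_) (fun n => (h n).2) ?_
    · rw [hv]
      positivity
    · simp_rw [hv]
      refine summable_geometric_two.congr fun n => ?_
      rw [show (4 : ℝ) ^ n = (2 ^ n) ^ 2 by rw [← pow_mul, mul_comm, pow_mul]; norm_num,
        Real.sqrt_sq (by positivity), one_div_pow]

lemma integral_bridgeKernel_sq {T α a b : ℝ} (hα : 1 / 2 < α) (hab : a ≤ b) (hb : b < T) :
    ∫ s in a..b, bridgeKernel T α s ^ 2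
      = ((T - b) ^ (-(2 * α - 1)) - (T - a) ^ (-(2 * α - 1))) / (2 * α - 1) := by
  have hκ : 2 * α - 1 ≠ 0 := by linarith
  have hd : ∀ s ∈ uIcc a b, HasDerivAt (fun s => (T - s) ^ (-(2 * α - 1)) / (2 * α - 1))
      (bridgeKernel T α s ^ 2) s := by
    intro s hs
    rw [uIcc_of_le hab] at hs
    have h1 : s < T := hs.2.trans_lt hb
    have h := (((hasDerivAt_id s).const_sub T).rpow_const (p := -(2 * α - 1))
      (Or.inl (by simp; linarith))).div_const (2 * α - 1)
    refine h.congr_deriv ?_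
    rw [bridgeKernel_sq h1]
    simp only [id]
    rw [show -(2 * α - 1) - 1 = -(2 * α) by ring]
    field_simp
  rw [intervalIntegral.integral_eq_sub_of_hasDerivAt hd]
  · ring
  · apply ContinuousOn.intervalIntegrable
    rw [uIcc_of_le hab]
    exact ContinuousOn.pow (fun s hs =>
      ((bridgeKernel_hyps hb).1 s hs).continuousAt.continuousWithinAt) 2

/-- Times converging to `T` at a Gaussian rate. -/
def gridTime (T : ℝ) (n : ℕ) : ℝ := T - T * (1 / 2) ^ (n ^ 2)

lemma gridTime_lt {T : ℝ} (hT : 0 < T) (n : ℕ) : gridTime T n < T := by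
  have : 0 < T * (1 / 2) ^ (n ^ 2) := by positivity
  unfold gridTime
  linarith

lemma gridTime_zero (T : ℝ) : gridTime T 0 = 0 := by simp [gridTime]

lemma monotone_gridTime {T : ℝ} (hT : 0 < T) : Monotone (gridTime T) := by
  intro m n hmn
  have : T * (1 / 2 : ℝ) ^ (n ^ 2) ≤ T * (1 / 2) ^ (m ^ 2) :=
    mul_le_mul_of_nonneg_left (pow_le_pow_of_le_one (by norm_num) (by norm_num)
      (Nat.pow_le_pow_left hmn 2)) hT.le
  unfold gridTime
  linarith

lemma gridTime_nonneg {T : ℝ} (hT : 0 < T) (n : ℕ) : 0 ≤ gridTime T n :=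
  (gridTime_zero T).symm.trans_le (monotone_gridTime hT n.zero_le)

lemma gridTime_ratio {T : ℝ} (hT : 0 < T) (n : ℕ) :
    (T - gridTime T (n + 1)) / (T - gridTime T n) = (1 / 2) ^ (2 * n + 1) := by
  unfold gridTime
  rw [sub_sub_cancel, sub_sub_cancel, mul_div_mul_left _ _ hT.ne',
    show (n + 1) ^ 2 = n ^ 2 + (2 * n + 1) by ring, pow_add, mul_div_cancel_left₀]
  positivity

/-- For `α > 1/2` the normalized bridge satisfies a law of large numbers along `gridTime`. -/
lemma ae_tendsto_cos_average (hB : IsStandardWiener P B) {T α : ℝ} (hT : 0 < T) (hα : 1 / 2 < α) :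
    ∀ᵐ ω ∂P, Tendsto (fun N : ℕ => (N : ℝ)⁻¹ * ∑ n ∈ Finset.range N,
      Real.cos ((T - gridTime T (n + 1)) ^ (-(1 / 2) : ℝ) *
        (extBridgePath T α B ω).1 (gridTime T (n + 1)))) atTop
      (𝓝 (Real.exp (-(1 / (2 * α - 1)) / 2))) := by
  set κ := 2 * α - 1 with hκ
  have hκ0 : 0 < κ := by linarith
  have hlt := gridTime_lt hT
  have hnn := gridTime_nonneg hT
  have hmono : ∀ n, gridTime T n ≤ gridTime T (n + 1) := fun n => monotone_gridTime hT n.le_succ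
  have hδ : ∀ n, 0 < T - gridTime T n := fun n => by linarith [hlt n]
  set q : ℕ → ℝ := fun n => ((1 / 2 : ℝ) ^ (2 * n + 1)) ^ κ with hq
  have hqδ : ∀ n, (T - gridTime T (n + 1)) ^ κ * (T - gridTime T n) ^ (-κ) = q n := fun n => by
    simp only [hq]
    rw [← gridTime_ratio hT n, Real.div_rpow (hδ _).le (hδ _).le, Real.rpow_neg (hδ _).le,
      div_eq_mul_inv]
  have hone : ∀ n, (T - gridTime T n) ^ κ * (T - gridTime T n) ^ (-κ) = 1 := fun n => by
    rw [← Real.rpow_add (hδ n), add_neg_cancel, Real.rpow_zero]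
  have hq1 : ∀ n, q n < 1 := fun n =>
    Real.rpow_lt_one (by positivity) (pow_lt_one₀ (by norm_num) (by norm_num) (by omega)) hκ0
  have hqsum : Summable fun n => q n / κ := by
    have hr : ((1 / 2 : ℝ)) ^ κ < 1 := Real.rpow_lt_one (by norm_num) (by norm_num) hκ0
    refine Summable.div_const (Summable.of_nonneg_of_le (fun n => by positivity) (fun n => ?_)
      (summable_geometric_of_lt_one (by positivity) hr)) κ
    rw [← Real.rpow_natCast, ← Real.rpow_mul (by norm_num), mul_comm κ, Real.rpow_mul (by norm_num),
      Real.rpow_natCast]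
    exact Real.rpow_le_rpow (by positivity)
      (pow_le_pow_of_le_one (by norm_num) (by norm_num) (by omega)) hκ0.le
  set w : ℕ → ℝ := fun n => ∫ s in gridTime T n..gridTime T (n + 1), bridgeKernel T α s ^ 2 with hw
  set d : ℕ → ℝ := fun n => (T - gridTime T (n + 1)) ^ (-(1 / 2) : ℝ) *
    (T - gridTime T (n + 1)) ^ α with hd
  have hd0 : ∀ n, 0 < d n := fun n =>
    mul_pos (Real.rpow_pos_of_pos (hδ _) _) (Real.rpow_pos_of_pos (hδ _) _)
  have hd2 : ∀ n, d n ^ 2 = (T - gridTime T (n + 1)) ^ κ := fun n => by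
    simp only [hd]
    rw [← Real.rpow_add (hδ _), ← Real.rpow_natCast, ← Real.rpow_mul (hδ _).le, hκ]
    congr 1
    push_cast
    ring
  have hdw : ∀ n, d n ^ 2 * w n = (1 - q n) / κ := fun n => by
    rw [hd2, hw]
    simp only
    rw [integral_bridgeKernel_sq hα (hmono n) (hlt _), ← hκ, mul_div_assoc', mul_sub, hone, hqδ]
  have hw0 : ∀ n, 0 < w n := fun n => by
    have h1 : 0 < d n ^ 2 * w n := by
      rw [hdw]
      exact div_pos (by linarith [hq1 n]) hκ0
    exact (pos_iff_pos_of_mul_pos h1).1 (pow_pos (hd0 n) 2)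
  set e : ℕ → ℝ := fun n => √(1 / κ / w n) with he
  have he2 : ∀ n, e n ^ 2 * w n = 1 / κ := fun n => by
    have := hw0 n
    rw [he, Real.sq_sqrt (by positivity), div_mul_cancel₀ _ this.ne']
  have hde : ∀ n, d n ≤ e n := fun n => by
    refine Real.le_sqrt_of_sq_le ?_
    rw [le_div_iff₀ (hw0 n), hdw]
    have : 0 ≤ q n := by positivity
    gcongr
    linarith
  -- the independent Gaussian blocks
  set ζ : ℕ → Ω → ℝ := fun n ω =>
    e n * bridgeInt T α B (gridTime T n) (gridTime T (n + 1)) ω with hζ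
  have hmeas : ∀ n, AEMeasurable (ζ n) P := fun n =>
    (aemeasurable_bridgeInt hB (hmono n) (hlt _)).const_mul _
  have hlaw : ∀ n, P.map (ζ n) = gaussianReal 0 (Real.toNNReal (1 / κ)) := fun n => by
    rw [hζ, map_const_mul_bridgeInt hB (hnn n) (hmono n) (hlt _), he2]
  have hcosm : Measurable Real.cos := Real.measurable_cos
  have hident : ∀ n, IdentDistrib (ζ n) (ζ 0) P P := fun n =>
    ⟨hmeas n, hmeas 0, by rw [hlaw, hlaw]⟩
  have hindep : ∀ m n, m < n → IndepFun (ζ m) (ζ n) P := fun m n hmn =>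
    (indepFun_bridgeInt hB (hnn m) (hmono m) (monotone_gridTime hT hmn) (hmono n) (hlt _)).comp
      (measurable_const_mul (e m)) (measurable_const_mul (e n))
  have hslln := strong_law_ae_real (μ := P) (fun n ω => Real.cos (ζ n ω))
    (Integrable.mono' (integrable_const (1 : ℝ))
      (hcosm.comp_aemeasurable (hmeas 0)).aestronglyMeasurable
      (ae_of_all _ fun ω => Real.abs_cos_le_one _))
    (fun m n hmn => by
      rcases lt_or_gt_of_ne hmn with h | h
      · exact (hindep m n h).comp hcosm hcosm
      · exact ((hindep n m h).comp hcosm hcosm).symm)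
    (fun n => (hident n).comp hcosm)
  have hmean : ∫ ω, Real.cos (ζ 0 ω) ∂P = Real.exp (-(1 / κ) / 2) := by
    rw [← integral_cos_gaussianReal (by positivity), ← hlaw 0,
      integral_map (hmeas 0) (by fun_prop)]
  -- the remainders
  have hrem1 := ae_tendsto_zero_of_gaussian
    (fun n => (aemeasurable_bridgeInt (α := α) hB (hnn n) (hlt n)).const_mul (d n))
    (fun n => map_const_mul_bridgeInt hB le_rfl (hnn n) (hlt n) (d n))
    (w := fun n => q n / κ) (fun n => by
      have h0 : 0 ≤ (T - gridTime T (n + 1)) ^ κ * (T - 0) ^ (-κ) :=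
        mul_nonneg (Real.rpow_nonneg (hδ _).le _) (Real.rpow_nonneg (by linarith) _)
      rw [integral_bridgeKernel_sq hα (hnn n) (hlt n), ← hκ, hd2, mul_div_assoc', mul_sub, hqδ]
      gcongr
      linarith) hqsum
  have hrem2 := ae_tendsto_zero_of_gaussian
    (fun n => (aemeasurable_bridgeInt (α := α) hB (hmono n) (hlt (n + 1))).const_mul (d n - e n))
    (fun n => map_const_mul_bridgeInt hB (hnn n) (hmono n) (hlt _) (d n - e n))
    (w := fun n => q n / κ) (fun n => by
      have h1 : (d n - e n) ^ 2 ≤ e n ^ 2 - d n ^ 2 := by nlinarith [hde n, hd0 n]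
      calc (d n - e n) ^ 2 * w n ≤ (e n ^ 2 - d n ^ 2) * w n :=
            mul_le_mul_of_nonneg_right h1 (hw0 n).le
        _ = q n / κ := by rw [sub_mul, he2, hdw]; ring) hqsum
  filter_upwards [hslln, hrem1, hrem2, ae_extBridgePath_apply hB hT (by linarith : 0 ≤ α), hB.cont]
    with ω h1 h2 h3 h4 h5
  rw [hmean] at h1
  set x : ℕ → ℝ := fun n => (T - gridTime T (n + 1)) ^ (-(1 / 2) : ℝ) *
    (extBridgePath T α B ω).1 (gridTime T (n + 1)) with hx
  have hxζ : ∀ n, x n - ζ n ω = d n * bridgeInt T α B 0 (gridTime T n) ω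
      + (d n - e n) * bridgeInt T α B (gridTime T n) (gridTime T (n + 1)) ω := fun n => by
    have h6 : bridgeInt T α B 0 (gridTime T n) ω
        + bridgeInt T α B (gridTime T n) (gridTime T (n + 1)) ω
        = bridgeInt T α B 0 (gridTime T (n + 1)) ω :=
      parts_add_parts (hnn n) (hmono n) (bridgeKernel_hyps (hlt _)).2 h5.continuousOn
    simp only [hx, hζ]
    rw [h4 _ (hnn _) (hlt _), ← h6]
    ring
  have hdiff : Tendsto (fun n => x n - ζ n ω) atTop (𝓝 0) := by
    simp_rw [hxζ]
    simpa using h2.add h3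
  have hcos : Tendsto (fun n => Real.cos (x n) - Real.cos (ζ n ω)) atTop (𝓝 0) :=
    squeeze_zero_norm (fun n => Real.abs_cos_sub_cos_le (x n) (ζ n ω))
      ((tendsto_zero_iff_abs_tendsto_zero _).1 hdiff)
  have hces := hcos.cesaro.add h1
  rw [zero_add] at hces
  refine hces.congr fun N => ?_
  rw [Finset.sum_sub_distrib]
  ring

/-- The laws of the bridges with distinct parameters `α, β > 1/2` are separated by a law of large
numbers. -/
lemma exists_separating_set_of_gt (hB : IsStandardWiener P B) {T α β : ℝ} (hT : 0 < T)
    (hα : 1 / 2 < α) (hβ : 1 / 2 < β) (hαβ : α ≠ β) :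
    ∃ S : Set (ContPathIcc T), MeasurableSet[borelSup T] S ∧
      (∀ᵐ ω ∂P, extBridgePath T β B ω ∈ S) ∧ ∀ᵐ ω ∂P, extBridgePath T α B ω ∉ S := by
  refine ⟨{y | Tendsto (fun N : ℕ => (N : ℝ)⁻¹ * ∑ n ∈ Finset.range N,
      Real.cos ((T - gridTime T (n + 1)) ^ (-(1 / 2) : ℝ) * y.1 (gridTime T (n + 1)))) atTop
      (𝓝 (Real.exp (-(1 / (2 * β - 1)) / 2)))}, ?_, ae_tendsto_cos_average hB hT hβ, ?_⟩
  · let _ : MeasurableSpace (ContPathIcc T) := borelSup T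
    refine measurableSet_tendsto _ fun N => Measurable.const_mul
      (Finset.measurable_fun_sum _ fun n _ => Real.measurable_cos.comp ?_) _
    exact (measurable_eval hT ⟨gridTime_nonneg hT _, (gridTime_lt hT _).le⟩).const_mul _
  · filter_upwards [ae_tendsto_cos_average hB hT hα] with ω h1 h2
    have h3 := Real.exp_injective (tendsto_nhds_unique h1 h2)
    have hα' : 2 * α - 1 ≠ 0 := by linarith
    have hβ' : 2 * β - 1 ≠ 0 := by linarith
    field_simp at h3
    exact hαβ (by linarith)

lemma exists_separating_set (hB : IsStandardWiener P B) {T α β : ℝ} (hT : 0 < T)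
    (hα : 0 ≤ α) (hαβ : α < β) :
    ∃ S : Set (ContPathIcc T), MeasurableSet[borelSup T] S ∧
      (∀ᵐ ω ∂P, extBridgePath T β B ω ∈ S) ∧ ∀ᵐ ω ∂P, extBridgePath T α B ω ∉ S := by
  rcases le_or_gt α (1 / 2) with h | h
  · exact exists_separating_set_of_le hB hT hα h hαβ
  · exact exists_separating_set_of_gt hB hT h (h.trans hαβ) hαβ.ne

lemma prob_preimage_eq_one {E : Type*} {f : Ω → E} {S : Set E} (h : ∀ᵐ ω ∂P, f ω ∈ S) :
    P (f ⁻¹' S) = 1 :=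
  (measure_congr (eventuallyEq_univ.2 h)).trans measure_univ

end Singularity

/-- For `α, β ≥ 0` with `α ≠ β`, the laws `P^T_{Y^{(α)},T}` and
`P^T_{Y^{(β)},T}` on `(C[0,T], ℬ(C[0,T]))` are mutually singular. In particular, for every
`α > 0` the law of `Y^{(α)}` is singular with respect to the standard Wiener measure on
`(C[0,T], ℬ(C[0,T]))` (which is the law of `Y^{(0)}`, i.e. of `B`). -/
theorem extension_laws_singular
    (P : Measure Ω) [IsProbabilityMeasure P]
    (T : ℝ) (hT : 0 < T) (B : ℝ → Ω → ℝ) (hB : IsStandardWiener P B) :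
    (∀ α β : ℝ, 0 ≤ α → 0 ≤ β → α ≠ β →
      ∃ S₁ S₂ : Set (ContPathIcc T),
        MeasurableSet[borelSup T] S₁ ∧ MeasurableSet[borelSup T] S₂ ∧ S₁ ∩ S₂ = ∅ ∧
        P (extBridgePath T α B ⁻¹' S₁) = 1 ∧ P (extBridgePath T β B ⁻¹' S₂) = 1) ∧
    (∀ α : ℝ, 0 < α →
      ∃ S₁ S₂ : Set (ContPathIcc T),
        MeasurableSet[borelSup T] S₁ ∧ MeasurableSet[borelSup T] S₂ ∧ S₁ ∩ S₂ = ∅ ∧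
        P (extBridgePath T α B ⁻¹' S₁) = 1 ∧ P (extBridgePath T 0 B ⁻¹' S₂) = 1) := by
  have key : ∀ α β : ℝ, 0 ≤ α → 0 ≤ β → α ≠ β →
      ∃ S₁ S₂ : Set (ContPathIcc T),
        MeasurableSet[borelSup T] S₁ ∧ MeasurableSet[borelSup T] S₂ ∧ S₁ ∩ S₂ = ∅ ∧
        P (extBridgePath T α B ⁻¹' S₁) = 1 ∧ P (extBridgePath T β B ⁻¹' S₂) = 1 := by
    intro α β hα hβ hαβ
    rcases lt_or_gt_of_ne hαβ with h | h
    · obtain ⟨S, hS, h1, h2⟩ := exists_separating_set hB hT hα h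
      exact ⟨Sᶜ, S, @MeasurableSet.compl _ _ (borelSup T) hS, hS, compl_inter_self S,
        prob_preimage_eq_one h2, prob_preimage_eq_one h1⟩
    · obtain ⟨S, hS, h1, h2⟩ := exists_separating_set hB hT hβ h
      exact ⟨S, Sᶜ, hS, @MeasurableSet.compl _ _ (borelSup T) hS, inter_compl_self S,
        prob_preimage_eq_one h1, prob_preimage_eq_one h2⟩
  exact ⟨key, fun α hα => key α 0 hα.le le_rfl hα.ne'⟩
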